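/- arXiv:2108.08293 — 4 statements merged into one kernel-verified Lean document; each statement's English description precedes it below -/
import Mathlib

section
/- For any two triangles V = (V₁,V₂,V₃) and W = (W₁,W₂,W₃) in ℝ², each with affinely independent vertices, there exist a point X ∈ ℝ², a real k > 0, and a permutation σ of {1,2,3} such that the pedal triangle P = 𝒫(V,X) satisfies dist(P_{σ(i)}, P_{σ(j)}) = k · dist(W_i, W_j) for all i, j ∈ {1,2,3}; that is, the pedal triangle of V with respect to X is similar to W. -/
open scoped InnerProductSpace

noncomputable section

/-- The Euclidean plane. -/
abbrev Plane := EuclideanSpace ℝ (Fin 2)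

/-- The foot of the perpendicular from `X` to the line through `A` and `B`
(the orthogonal projection of `X` onto that line, when `A ≠ B`). -/
noncomputable def foot (A B X : Plane) : Plane :=
  A + (⟪X - A, B - A⟫_ℝ / ⟪B - A, B - A⟫_ℝ) • (B - A)

/-- The pedal polygon of the `n`-gon `V` with respect to the point `X`:
its `i`-th vertex is the orthogonal projection of `X` onto the line through
`V i` and `V (i+1)` (indices mod `n`). -/
noncomputable def pedal {n : ℕ} (V : ZMod n → Plane) (X : Plane) : ZMod n → Plane :=
  fun i => foot (V i) (V (i + 1)) X

open scoped ComplexConjugate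

/-- The foot of the perpendicular from `x` to the line through `a` and `b`, in complex
coordinates. -/
def complexFoot (a b x : ℂ) : ℂ :=
  a + ((x - a) + (b - a) / conj (b - a) * conj (x - a)) / 2

/-- The identification of the Euclidean plane with the complex numbers. -/
def toComplex (p : Plane) : ℂ := ⟨p 0, p 1⟩

lemma toComplex_injective : Function.Injective toComplex := by
  intro p q h
  ext i
  fin_cases i
  · exact congrArg Complex.re h
  · exact congrArg Complex.im h

lemma exists_toComplex_eq (z : ℂ) : ∃ p : Plane, toComplex p = z :=
  ⟨!₂[z.re, z.im], by simp [toComplex]⟩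

lemma dist_eq_norm_toComplex (p q : Plane) : dist p q = ‖toComplex p - toComplex q‖ := by
  rw [EuclideanSpace.dist_eq, Complex.norm_def, Complex.normSq_apply]
  simp [toComplex, Real.dist_eq, sq]

lemma toComplex_foot {A B : Plane} (h : A ≠ B) (X : Plane) :
    toComplex (foot A B X) = complexFoot (toComplex A) (toComplex B) (toComplex X) := by
  have hz : toComplex B - toComplex A ≠ 0 :=
    sub_ne_zero.2 fun e => h (toComplex_injective e.symm)
  have hn : (B 0 - A 0) * (B 0 - A 0) + (B 1 - A 1) * (B 1 - A 1) ≠ 0 := by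
    simpa [Complex.normSq_apply, toComplex] using (Complex.normSq_eq_zero.not.2 hz)
  have hu : (toComplex B - toComplex A) / conj (toComplex B - toComplex A) =
      (toComplex B - toComplex A) ^ 2 /
        (((B 0 - A 0) * (B 0 - A 0) + (B 1 - A 1) * (B 1 - A 1) : ℝ) : ℂ) := by
    rw [div_eq_div_iff ((map_ne_zero _).2 hz) (by exact_mod_cast hn)]
    apply Complex.ext <;> simp [toComplex, sq] <;> ring
  have hf (i : Fin 2) : foot A B X i = A i +
      ((X 0 - A 0) * (B 0 - A 0) + (X 1 - A 1) * (B 1 - A 1)) /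
        ((B 0 - A 0) * (B 0 - A 0) + (B 1 - A 1) * (B 1 - A 1)) * (B i - A i) := by
    simp only [foot, PiLp.add_apply, PiLp.smul_apply, PiLp.sub_apply, smul_eq_mul,
      PiLp.inner_apply, Fin.sum_univ_two, RCLike.inner_apply, conj_trivial]
    ring
  rw [complexFoot, hu]
  generalize hN : (B 0 - A 0) * (B 0 - A 0) + (B 1 - A 1) * (B 1 - A 1) = N at *
  apply Complex.ext
  · simp [toComplex, hf, Complex.div_ofReal_re, Complex.div_ofReal_im, sq]
    field_simp
    linear_combination (X 0 - A 0) * hN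
  · simp [toComplex, hf, Complex.div_ofReal_re, Complex.div_ofReal_im, sq]
    field_simp
    linear_combination (X 1 - A 1) * hN

lemma complexFoot_mem_line {a b : ℂ} (h : b - a ≠ 0) (x : ℂ) :
    (complexFoot a b x - a) * conj (b - a) = conj (complexFoot a b x - a) * (b - a) := by
  have h' : conj (b - a) ≠ 0 := (map_ne_zero _).2 h
  rw [map_sub] at h'
  simp only [complexFoot, map_sub, map_add, map_mul, map_div₀, Complex.conj_conj, map_ofNat]
  field_simp
  ring

lemma cross_ne_of_affineIndependent {V : ZMod 3 → Plane} (hV : AffineIndependent ℝ V) :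
    (toComplex (V 1) - toComplex (V 0)) * conj (toComplex (V 2) - toComplex (V 0)) ≠
      conj (toComplex (V 1) - toComplex (V 0)) * (toComplex (V 2) - toComplex (V 0)) := by
  intro h
  have hc : (V 1 1 - V 0 1) * (V 2 0 - V 0 0) = (V 1 0 - V 0 0) * (V 2 1 - V 0 1) := by
    have := congrArg Complex.im h
    simp [toComplex] at this
    linarith
  set p : ℝ := (V 2 0 - V 0 0) * (V 1 0 - V 0 0) + (V 2 1 - V 0 1) * (V 1 1 - V 0 1) with hp
  set q : ℝ := (V 1 0 - V 0 0) * (V 1 0 - V 0 0) + (V 1 1 - V 0 1) * (V 1 1 - V 0 1) with hq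
  let w : Fin 3 → ℝ := ![q - p, p, -q]
  have key := (affineIndependent_iff.1 hV) Finset.univ w
    ((Fin.sum_univ_three w).trans (by simp [w]))
    ((Fin.sum_univ_three fun i : Fin 3 => w i • (V : Fin 3 → Plane) i).trans (by
      change (q - p) • V 0 + p • V 1 + (-q) • V 2 = 0
      ext i
      fin_cases i
      · simp [hp, hq]
        linear_combination (V 1 1 - V 0 1) * (-hc)
      · simp [hp, hq]
        linear_combination (V 1 0 - V 0 0) * hc))
  have hq0 : -q = 0 := key 2 (Finset.mem_univ _)
  have h0 : V 1 0 - V 0 0 = 0 := by nlinarith [sq_nonneg (V 1 0 - V 0 0), sq_nonneg (V 1 1 - V 0 1)]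
  have h1 : V 1 1 - V 0 1 = 0 := by nlinarith [sq_nonneg (V 1 0 - V 0 0), sq_nonneg (V 1 1 - V 0 1)]
  have : V 1 = V 0 := by
    ext i
    fin_cases i
    · exact sub_eq_zero.1 h0
    · exact sub_eq_zero.1 h1
  exact absurd (hV.injective this) (by decide)

/-- The feet on the sides of a nondegenerate triangle form a triangle directly similar to
`0, s, t`, for a suitable point `x`, provided `0, s, t` is not directly similar to the triangle
formed by the squared unit directions of the sides. -/
lemma exists_complexFoot_similar {v₀ v₁ v₂ s t : ℂ}
    (hv : (v₁ - v₀) * conj (v₂ - v₀) ≠ conj (v₁ - v₀) * (v₂ - v₀))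
    (h₀ : v₁ - v₀ ≠ 0) (h₁ : v₂ - v₁ ≠ 0) (h₂ : v₀ - v₂ ≠ 0) (hs : s ≠ 0)
    (hD : ((v₂ - v₁) / conj (v₂ - v₁) - (v₁ - v₀) / conj (v₁ - v₀)) * t ≠
      ((v₀ - v₂) / conj (v₀ - v₂) - (v₁ - v₀) / conj (v₁ - v₀)) * s) :
    ∃ x z : ℂ, z ≠ 0 ∧ complexFoot v₁ v₂ x - complexFoot v₀ v₁ x = z * s ∧
      complexFoot v₂ v₀ x - complexFoot v₀ v₁ x = z * t := by
  obtain ⟨x, hx⟩ : ∃ x : ℂ, (complexFoot v₁ v₂ x - complexFoot v₀ v₁ x) * t =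
      (complexFoot v₂ v₀ x - complexFoot v₀ v₁ x) * s := by
    have hD' := sub_ne_zero.2 hD
    set a := (v₁ - v₀) / conj (v₁ - v₀)
    set b := (v₂ - v₁) / conj (v₂ - v₁)
    set c := (v₀ - v₂) / conj (v₀ - v₂)
    set D := (b - a) * t - (c - a) * s with hDdef
    let y := ((v₂ - c * conj v₂ - v₀ + a * conj v₀) * s -
      (v₁ - b * conj v₁ - v₀ + a * conj v₀) * t) / D
    have hy : y * D = (v₂ - c * conj v₂ - v₀ + a * conj v₀) * s -
      (v₁ - b * conj v₁ - v₀ + a * conj v₀) * t := div_mul_cancel₀ _ hD'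
    refine ⟨conj y, ?_⟩
    simp only [complexFoot, map_sub (starRingEnd ℂ) (conj y), Complex.conj_conj]
    change (v₁ + (conj y - v₁ + b * (y - conj v₁)) / 2 -
      (v₀ + (conj y - v₀ + a * (y - conj v₀)) / 2)) * t =
      (v₂ + (conj y - v₂ + c * (y - conj v₂)) / 2 -
      (v₀ + (conj y - v₀ + a * (y - conj v₀)) / 2)) * s
    rw [hDdef] at hy
    linear_combination hy / 2
  refine ⟨x, (complexFoot v₁ v₂ x - complexFoot v₀ v₁ x) / s, ?_, by field_simp, ?_⟩
  · intro hz
    have e₁ : complexFoot v₁ v₂ x - complexFoot v₀ v₁ x = 0 := by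
      simpa [hs] using hz
    have e₂ : complexFoot v₂ v₀ x - complexFoot v₀ v₁ x = 0 := by
      rw [e₁, zero_mul, eq_comm] at hx
      simpa [hs] using hx
    have l₀ := complexFoot_mem_line h₀ x
    have l₁ := complexFoot_mem_line h₁ x
    have l₂ := complexFoot_mem_line h₂ x
    rw [sub_eq_zero.1 e₁] at l₁
    rw [sub_eq_zero.1 e₂] at l₂
    apply hv
    simp only [map_sub] at l₀ l₁ l₂ ⊢
    linear_combination -l₀ - l₁ - l₂
  · rw [div_mul_eq_mul_div, hx]
    field_simp

/-- A nondegenerate triangle and its mirror image are not both directly similar to the triangle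
formed by the squared unit directions of the sides of another nondegenerate triangle. -/
lemma not_similar_or_not_similar_conj {a b c s t : ℂ} (hab : b - a ≠ 0)
    (hst : s * conj t ≠ conj s * t) :
    (b - a) * t ≠ (c - a) * s ∨ (b - a) * conj t ≠ (c - a) * conj s := by
  by_contra! h
  obtain ⟨h₁, h₂⟩ := h
  apply hst
  apply mul_left_cancel₀ hab
  linear_combination s * h₂ - conj s * h₁

lemma dist_pedal_eq_of_similar {V W : ZMod 3 → Plane} {X : Plane} (g : ℂ → ℂ)
    (hg : ∀ a b, ‖g a - g b‖ = ‖a - b‖) {z : ℂ}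
    (h₁ : toComplex (pedal V X 1) - toComplex (pedal V X 0) =
      z * (g (toComplex (W 1)) - g (toComplex (W 0))))
    (h₂ : toComplex (pedal V X 2) - toComplex (pedal V X 0) =
      z * (g (toComplex (W 2)) - g (toComplex (W 0)))) (i j : ZMod 3) :
    dist (pedal V X i) (pedal V X j) = ‖z‖ * dist (W i) (W j) := by
  have h : ∀ i : ZMod 3, toComplex (pedal V X i) =
      toComplex (pedal V X 0) + z * (g (toComplex (W i)) - g (toComplex (W 0))) := by
    intro i
    obtain rfl | rfl | rfl : i = 0 ∨ i = 1 ∨ i = 2 := by revert i; decide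
    · ring
    · linear_combination h₁
    · linear_combination h₂
  rw [dist_eq_norm_toComplex, dist_eq_norm_toComplex, ← hg (toComplex (W i)), ← norm_mul, h i, h j]
  congr 1
  ring

/-- **Existence of pedal centers.** For any two nondegenerate triangles `V` and `W`,
there is a point `X` such that the pedal triangle of `V` with respect to `X`
is similar to `W`. -/
theorem exists_pedal_center
    (V W : ZMod 3 → Plane)
    (hV : AffineIndependent ℝ V) (hW : AffineIndependent ℝ W) :
    ∃ (X : Plane) (k : ℝ) (σ : Equiv.Perm (ZMod 3)), 0 < k ∧
      ∀ i j : ZMod 3,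
        dist (pedal V X (σ i)) (pedal V X (σ j)) = k * dist (W i) (W j) := by
  have hv := cross_ne_of_affineIndependent hV
  have hw := cross_ne_of_affineIndependent hW
  have ne : ∀ {U : ZMod 3 → Plane}, AffineIndependent ℝ U → ∀ i j : ZMod 3, i ≠ j →
      toComplex (U i) - toComplex (U j) ≠ 0 := fun hU i j hij =>
    sub_ne_zero.2 fun e => hij (hU.injective (toComplex_injective e))
  have h₀ := ne hV 1 0 (by decide)
  have h₁ := ne hV 2 1 (by decide)
  have h₂ := ne hV 0 2 (by decide)
  have hs := ne hW 1 0 (by decide)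
  have f₀ : ∀ X, toComplex (pedal V X 0) =
      complexFoot (toComplex (V 0)) (toComplex (V 1)) (toComplex X) :=
    toComplex_foot (hV.injective.ne (by decide))
  have f₁ : ∀ X, toComplex (pedal V X 1) =
      complexFoot (toComplex (V 1)) (toComplex (V 2)) (toComplex X) :=
    toComplex_foot (hV.injective.ne (by decide))
  have f₂ : ∀ X, toComplex (pedal V X 2) =
      complexFoot (toComplex (V 2)) (toComplex (V 0)) (toComplex X) :=
    toComplex_foot (hV.injective.ne (by decide))
  have hu : (toComplex (V 2) - toComplex (V 1)) / conj (toComplex (V 2) - toComplex (V 1)) -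
      (toComplex (V 1) - toComplex (V 0)) / conj (toComplex (V 1) - toComplex (V 0)) ≠ 0 := by
    rw [sub_ne_zero]
    intro e
    rw [div_eq_div_iff ((map_ne_zero _).2 h₁) ((map_ne_zero _).2 h₀)] at e
    apply hv
    simp only [map_sub] at e ⊢
    linear_combination -e
  have finish : ∀ g : ℂ → ℂ, (∀ a b, ‖g a - g b‖ = ‖a - b‖) →
      (∃ x z : ℂ, z ≠ 0 ∧
        complexFoot (toComplex (V 1)) (toComplex (V 2)) x -
          complexFoot (toComplex (V 0)) (toComplex (V 1)) x =
            z * (g (toComplex (W 1)) - g (toComplex (W 0))) ∧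
        complexFoot (toComplex (V 2)) (toComplex (V 0)) x -
          complexFoot (toComplex (V 0)) (toComplex (V 1)) x =
            z * (g (toComplex (W 2)) - g (toComplex (W 0)))) →
      ∃ (X : Plane) (k : ℝ) (σ : Equiv.Perm (ZMod 3)), 0 < k ∧
      ∀ i j : ZMod 3,
        dist (pedal V X (σ i)) (pedal V X (σ j)) = k * dist (W i) (W j) := by
    rintro g hg ⟨x, z, hz, e₁, e₂⟩
    obtain ⟨X, rfl⟩ := exists_toComplex_eq x
    rw [← f₀, ← f₁] at e₁
    rw [← f₀, ← f₂] at e₂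
    exact ⟨X, ‖z‖, 1, norm_pos_iff.2 hz, dist_pedal_eq_of_similar g hg e₁ e₂⟩
  rcases not_similar_or_not_similar_conj hu hw with hD | hD
  · exact finish id (fun _ _ => rfl) (exists_complexFoot_similar hv h₀ h₁ h₂ hs hD)
  · refine finish conj (fun a b => by rw [← map_sub, Complex.norm_conj]) ?_
    simp only [← map_sub (starRingEnd ℂ) (toComplex (W _))]
    exact exists_complexFoot_similar hv h₀ h₁ h₂ ((map_ne_zero _).2 hs) hD
end
end

section
/- Let V = (V_1,…,V_n) be an n-gon in ℝ² (n ≥ 3, indices mod n) and X ∈ ℝ² a point. Define iterates V⁰ = V and Vᵏ = 𝒫(Vᵏ⁻¹, X) for k ≥ 1. Assume that for each k ∈ {0,1,…,n−1}, no three successive vertices of Vᵏ are collinear (in particular consecutive vertices of Vᵏ are distinct) and X does not lie on any of the lines through two consecutive vertices of Vᵏ. Then the n-fold pedal polygon Vⁿ is directly similar to V with the same labeling: there exists k > 0 such that dist(Vⁿ_i, Vⁿ_j) = k · dist(V_i, V_j) for all i, j. -/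
open scoped InnerProductSpace

noncomputable section

/-- Iterated pedal polygons with respect to a single point `X`. -/
noncomputable def pedalIter {n : ℕ} (V : ZMod n → Plane) (X : Plane) : ℕ → ZMod n → Plane
  | 0 => V
  | k + 1 => pedal (pedalIter V X k) X

/-- The planar cross product of two complex numbers. -/
def cross (a b : ℂ) : ℝ := a.re * b.im - a.im * b.re

/-- The real dot product of two complex numbers. -/
def dot (a b : ℂ) : ℝ := a.re * b.re + a.im * b.im

/-- The cotangent of the directed angle at `a` in the triangle `0, a, b`. -/
def cotFst (a b : ℂ) : ℝ := dot a (b - a) / cross a b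

/-- The cotangent of the directed angle at `b` in the triangle `0, a, b`. -/
def cotSnd (a b : ℂ) : ℝ := dot b (b - a) / cross a b

/-- The foot of the perpendicular from `0` to the line through `a` and `b`. -/
def footZero (a b : ℂ) : ℂ :=
  ⟨cross a b * (b - a).im / dot (b - a) (b - a), -(cross a b * (b - a).re / dot (b - a) (b - a))⟩

theorem dot_self_ne_zero {a : ℂ} (h : a ≠ 0) : dot a a ≠ 0 := by
  intro h0
  apply h
  have h1 : a.re = 0 := by unfold dot at h0; nlinarith [sq_nonneg a.re, sq_nonneg a.im]
  have h2 : a.im = 0 := by unfold dot at h0; nlinarith [sq_nonneg a.re, sq_nonneg a.im]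
  exact Complex.ext h1 h2

theorem ne_of_cross_ne_zero {a b : ℂ} (h : cross a b ≠ 0) : b - a ≠ 0 := by
  intro h0
  rw [sub_eq_zero] at h0
  subst h0
  apply h
  unfold cross
  ring

theorem cross_footZero (a b c : ℂ) :
    cross (footZero a b) (footZero b c) =
      cross a b * cross b c * cross (b - a) (c - b) /
        (dot (b - a) (b - a) * dot (c - b) (c - b)) := by
  simp only [cross, footZero]
  ring

theorem cross_footZero_ne_zero {a b c : ℂ} (hab : cross a b ≠ 0) (hbc : cross b c ≠ 0)
    (h : cross (b - a) (c - b) ≠ 0) : cross (footZero a b) (footZero b c) ≠ 0 := by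
  rw [cross_footZero]
  have h1 := dot_self_ne_zero (ne_of_cross_ne_zero hab)
  have h2 := dot_self_ne_zero (ne_of_cross_ne_zero hbc)
  positivity

theorem dot_footZero (a b c : ℂ) :
    dot (footZero a b) (footZero b c) =
      cross a b * cross b c * dot (b - a) (c - b) /
        (dot (b - a) (b - a) * dot (c - b) (c - b)) := by
  simp only [footZero]
  generalize dot (b - a) (b - a) = p
  generalize dot (c - b) (c - b) = q
  simp only [dot]
  ring

theorem dot_footZero_self {a b : ℂ} (hab : cross a b ≠ 0) :
    dot (footZero a b) (footZero a b) = cross a b ^ 2 / dot (b - a) (b - a) := by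
  have h1 := dot_self_ne_zero (ne_of_cross_ne_zero hab)
  simp only [footZero]
  generalize hp : dot (b - a) (b - a) = p at h1
  simp only [dot] at hp ⊢
  field_simp
  linear_combination hp

theorem dot_sub_right (a b c : ℂ) : dot a (b - c) = dot a b - dot a c := by
  simp only [dot, Complex.sub_re, Complex.sub_im]
  ring

theorem dot_comm (a b : ℂ) : dot a b = dot b a := by
  simp only [dot]
  ring

theorem cotFst_footZero {a b c : ℂ} (hab : cross a b ≠ 0) (hbc : cross b c ≠ 0)
    (h : cross (b - a) (c - b) ≠ 0) :
    cotFst (footZero a b) (footZero b c) = cotFst b c := by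
  have h1 := dot_self_ne_zero (ne_of_cross_ne_zero hab)
  have h2 := dot_self_ne_zero (ne_of_cross_ne_zero hbc)
  have key : cross b c * dot (b - a) (c - b) - cross a b * dot (c - b) (c - b) =
      dot b (c - b) * cross (b - a) (c - b) := by
    simp only [cross, dot, Complex.sub_re, Complex.sub_im]
    ring
  rw [cotFst, cotFst, dot_sub_right, cross_footZero, dot_footZero, dot_footZero_self hab]
  field_simp
  linear_combination key

theorem cotSnd_footZero {a b c : ℂ} (hab : cross a b ≠ 0) (hbc : cross b c ≠ 0)
    (h : cross (b - a) (c - b) ≠ 0) :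
    cotSnd (footZero a b) (footZero b c) = cotSnd a b := by
  have h1 := dot_self_ne_zero (ne_of_cross_ne_zero hab)
  have h2 := dot_self_ne_zero (ne_of_cross_ne_zero hbc)
  have key : cross b c * dot (b - a) (b - a) - cross a b * dot (b - a) (c - b) =
      dot b (b - a) * cross (b - a) (c - b) := by
    simp only [cross, dot, Complex.sub_re, Complex.sub_im]
    ring
  rw [cotSnd, cotSnd, dot_sub_right, dot_comm (footZero b c) (footZero a b), cross_footZero,
    dot_footZero, dot_footZero_self hbc]
  field_simp
  linear_combination key

/-- The cotangents of the two angles determine the ratio of the sides at `0`. -/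
theorem eq_mul_of_cross_ne_zero {a b : ℂ} (h : cross a b ≠ 0) :
    b = a * ⟨1 + cotFst a b * ((cotSnd a b - cotFst a b) / (cotFst a b ^ 2 + 1)),
      (cotSnd a b - cotFst a b) / (cotFst a b ^ 2 + 1)⟩ := by
  have ha : a ≠ 0 := by
    rintro rfl
    simp [cross] at h
  have hd := dot_self_ne_zero (ne_of_cross_ne_zero h)
  have ha' := dot_self_ne_zero ha
  have hsum : cotSnd a b - cotFst a b = dot (b - a) (b - a) / cross a b := by
    rw [cotSnd, cotFst, ← sub_div]
    simp only [dot, Complex.sub_re, Complex.sub_im]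
    ring
  have hsq : cotFst a b ^ 2 + 1 = dot a a * dot (b - a) (b - a) / cross a b ^ 2 := by
    rw [cotFst]
    field_simp
    simp only [dot, cross, Complex.sub_re, Complex.sub_im]
    ring
  have hy : (cotSnd a b - cotFst a b) / (cotFst a b ^ 2 + 1) = cross a b / dot a a := by
    rw [hsum, hsq]
    field_simp
  have hx : 1 + cotFst a b * (cross a b / dot a a) = dot a b / dot a a := by
    rw [cotFst, dot_sub_right]
    field_simp
    ring
  rw [hy, hx]
  apply Complex.ext
  · simp only [Complex.mul_re]
    field_simp
    simp only [dot, cross]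
    ring
  · simp only [Complex.mul_im]
    field_simp
    simp only [dot, cross]
    ring

theorem mul_eq_mul_of_cot_eq {a b a' b' : ℂ} (h : cross a b ≠ 0) (h' : cross a' b' ≠ 0)
    (hfst : cotFst a' b' = cotFst a b) (hsnd : cotSnd a' b' = cotSnd a b) :
    b' * a = a' * b := by
  have e := eq_mul_of_cross_ne_zero h
  have e' := eq_mul_of_cross_ne_zero h'
  rw [hfst, hsnd] at e'
  rw [e']
  conv_rhs => rw [e]
  ring

/-- The complex coordinate of `A` in the frame with origin `X`. -/
def relCoord (X A : Plane) : ℂ := ⟨A 0 - X 0, A 1 - X 1⟩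

theorem dist_relCoord (X A B : Plane) : dist (relCoord X A) (relCoord X B) = dist A B := by
  rw [EuclideanSpace.dist_eq, Complex.dist_eq_re_im, Fin.sum_univ_two]
  simp [relCoord, Real.dist_eq, sq_abs]

theorem relCoord_sub_ne_zero {X A B : Plane} (h : A ≠ B) : relCoord X B - relCoord X A ≠ 0 := by
  intro h0
  apply h
  rw [← dist_eq_zero, ← dist_relCoord X, dist_eq_zero]
  exact (sub_eq_zero.mp h0).symm

theorem relCoord_foot {X A B : Plane} (h : A ≠ B) :
    relCoord X (foot A B X) = footZero (relCoord X A) (relCoord X B) := by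
  have hd := dot_self_ne_zero (relCoord_sub_ne_zero (X := X) h)
  simp only [dot, relCoord, Complex.sub_re, Complex.sub_im] at hd
  apply Complex.ext <;>
  · simp only [relCoord, foot, footZero, dot, cross, PiLp.inner_apply, Fin.sum_univ_two,
      PiLp.add_apply, PiLp.smul_apply, PiLp.sub_apply, smul_eq_mul, RCLike.inner_apply,
      Complex.sub_re, Complex.sub_im, conj_trivial]
    have hd' : (B 0 - A 0) * (B 0 - A 0) + (B 1 - A 1) * (B 1 - A 1) ≠ 0 := by
      convert hd using 1
      ring
    have e : (B 0 - X 0 - (A 0 - X 0)) * (B 0 - X 0 - (A 0 - X 0)) +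
        (B 1 - X 1 - (A 1 - X 1)) * (B 1 - X 1 - (A 1 - X 1)) =
        (B 0 - A 0) * (B 0 - A 0) + (B 1 - A 1) * (B 1 - A 1) := by ring
    rw [e]
    generalize hD : (B 0 - A 0) * (B 0 - A 0) + (B 1 - A 1) * (B 1 - A 1) = D at hd'
    field_simp
    rw [← hD]
    ring

theorem foot_mem_affineSpan (A B X : Plane) : foot A B X ∈ affineSpan ℝ ({A, B} : Set Plane) := by
  have := AffineMap.lineMap_mem_affineSpan_pair
    (⟪X - A, B - A⟫_ℝ / ⟪B - A, B - A⟫_ℝ) A B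
  rwa [AffineMap.lineMap_apply, vsub_eq_sub, vadd_eq_add, add_comm] at this

theorem mem_affineSpan_of_cross_eq_zero {A B X : Plane} (h : A ≠ B)
    (h0 : cross (relCoord X A) (relCoord X B) = 0) :
    X ∈ affineSpan ℝ ({A, B} : Set Plane) := by
  have e : foot A B X = X := by
    rw [← dist_eq_zero, ← dist_relCoord X, dist_eq_zero, relCoord_foot h]
    rw [footZero, h0]
    simp [relCoord]
  rw [← e]
  exact foot_mem_affineSpan A B X

theorem collinear_of_cross_eq_zero {X A B C : Plane} (h : A ≠ B)
    (h0 : cross (relCoord X B - relCoord X A) (relCoord X C - relCoord X B) = 0) :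
    Collinear ℝ ({A, B, C} : Set Plane) := by
  have hC : C ∈ affineSpan ℝ ({A, B} : Set Plane) := by
    apply mem_affineSpan_of_cross_eq_zero h
    simp only [cross, relCoord, Complex.sub_re, Complex.sub_im] at h0 ⊢
    linear_combination h0
  have := collinear_insert_of_mem_affineSpan_pair hC
  convert this using 1
  ext x
  simp only [Set.mem_insert_iff, Set.mem_singleton_iff]
  tauto

theorem ne_of_not_collinear {A B C : Plane} (h : ¬ Collinear ℝ ({A, B, C} : Set Plane)) :
    A ≠ B := by
  rintro rfl
  apply h
  rw [Set.insert_eq_of_mem (Set.mem_insert _ _)]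
  exact collinear_pair ℝ A C

/-- **The n-fold pedal polygon is similar to the original.** If at every stage
`k = 0, 1, …, n-1` no three successive vertices of the iterated pedal polygon are
collinear and `X` lies on none of the lines through two consecutive vertices, then
the `n`-fold pedal polygon of an `n`-gon `V` with respect to `X` is directly similar
to `V` with the same labeling. -/
theorem pedalIter_n_similar
    (n : ℕ) [NeZero n] (hn : 3 ≤ n)
    (V : ZMod n → Plane) (X : Plane)
    (hcol : ∀ k : ℕ, k < n → ∀ i : ZMod n,
      ¬ Collinear ℝ
        ({pedalIter V X k i, pedalIter V X k (i + 1), pedalIter V X k (i + 2)} : Set Plane))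
    (hX : ∀ k : ℕ, k < n → ∀ i : ZMod n,
      X ∉ affineSpan ℝ ({pedalIter V X k i, pedalIter V X k (i + 1)} : Set Plane)) :
    ∃ k : ℝ, 0 < k ∧
      ∀ i j : ZMod n, dist (pedalIter V X n i) (pedalIter V X n j) = k * dist (V i) (V j) := by
  let z : ℕ → ZMod n → ℂ := fun k i => relCoord X (pedalIter V X k i)
  have hne : ∀ k < n, ∀ i, pedalIter V X k i ≠ pedalIter V X k (i + 1) :=
    fun k hk i => ne_of_not_collinear (hcol k hk i)
  have hcross : ∀ k < n, ∀ i, cross (z k i) (z k (i + 1)) ≠ 0 :=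
    fun k hk i h0 => hX k hk i (mem_affineSpan_of_cross_eq_zero (hne k hk i) h0)
  have hside : ∀ k < n, ∀ i,
      cross (z k (i + 1) - z k i) (z k (i + 1 + 1) - z k (i + 1)) ≠ 0 := by
    intro k hk i h0
    apply hcol k hk i
    have e : i + 2 = i + 1 + 1 := by ring
    rw [e]
    exact collinear_of_cross_eq_zero (hne k hk i) h0
  have hstep : ∀ k < n, ∀ i, z (k + 1) i = footZero (z k i) (z k (i + 1)) :=
    fun k hk i => relCoord_foot (hne k hk i)
  have hinv : ∀ k ≤ n, ∀ i, cross (z k i) (z k (i + 1)) ≠ 0 ∧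
      cotFst (z k i) (z k (i + 1)) = cotFst (z 0 (i + k)) (z 0 (i + k + 1)) ∧
      cotSnd (z k i) (z k (i + 1)) = cotSnd (z 0 i) (z 0 (i + 1)) := by
    intro k
    induction k with
    | zero =>
      intro _ i
      refine ⟨hcross 0 (by omega) i, by simp, rfl⟩
    | succ k ih =>
      intro hk i
      have hk' : k < n := by omega
      have h1 := hcross k hk' i
      have h2 := hcross k hk' (i + 1)
      have h3 := hside k hk' i
      rw [hstep k hk' i, hstep k hk' (i + 1)]
      refine ⟨cross_footZero_ne_zero h1 h2 h3, ?_, ?_⟩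
      · rw [cotFst_footZero h1 h2 h3, (ih hk'.le (i + 1)).2.1]
        have e : i + 1 + (k : ZMod n) = i + ((k + 1 : ℕ) : ZMod n) := by
          push_cast
          ring
        rw [e]
      · rw [cotSnd_footZero h1 h2 h3, (ih hk'.le i).2.2]
  have hz : ∀ k ≤ n, ∀ i, z k i ≠ 0 := by
    intro k hk i h0
    apply (hinv k hk i).1
    simp [h0, cross]
  have hratio : ∀ i, z n (i + 1) * z 0 i = z n i * z 0 (i + 1) := by
    intro i
    obtain ⟨h1, h2, h3⟩ := hinv n le_rfl i
    rw [ZMod.natCast_self, add_zero] at h2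
    exact mul_eq_mul_of_cot_eq (hinv 0 (Nat.zero_le n) i).1 h1 h2 h3
  have hnat : ∀ m : ℕ, z n (m : ZMod n) = z n 0 / z 0 0 * z 0 (m : ZMod n) := by
    intro m
    have h0 := hz 0 (Nat.zero_le n)
    induction m with
    | zero =>
      have := h0 0
      rw [Nat.cast_zero]
      field_simp
    | succ m ih =>
      have hr := hratio (m : ZMod n)
      rw [ih] at hr
      rw [Nat.cast_succ]
      apply mul_right_cancel₀ (h0 (m : ZMod n))
      rw [hr]
      ring
  have hall : ∀ i, z n i = z n 0 / z 0 0 * z 0 i := by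
    intro i
    have := hnat i.val
    rwa [ZMod.natCast_zmod_val] at this
  refine ⟨‖z n 0 / z 0 0‖,
    norm_pos_iff.mpr (div_ne_zero (hz n le_rfl 0) (hz 0 (Nat.zero_le n) 0)), ?_⟩
  intro i j
  rw [← dist_relCoord X, ← dist_relCoord X (V i) (V j)]
  change dist (z n i) (z n j) = _ * dist (z 0 i) (z 0 j)
  rw [hall i, hall j, dist_eq_norm, dist_eq_norm, ← mul_sub, norm_mul]
end
end

section
/- For any square V = (V_1,V_2,V_3,V_4) and any rectangle W = (W_1,W_2,W_3,W_4) in ℝ², there exist points X_1, X_2 ∈ ℝ² such that the twice-iterated pedal polygon 𝒫(𝒫(V,X_1),X_2) is well defined (the intermediate polygon 𝒫(V,X_1) has no three successive vertices collinear) and is similar to W. In particular V ⊥ W. -/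
open scoped InnerProductSpace

noncomputable section

/-- No three successive vertices of the `n`-gon `V` are collinear. -/
def NoThreeCollinear {n : ℕ} (V : ZMod n → Plane) : Prop :=
  ∀ i : ZMod n, ¬ Collinear ℝ ({V i, V (i + 1), V (i + 2)} : Set Plane)

/-- Two `n`-gons are similar: there are `k > 0` and a bijection `τ` of `ZMod n` of the
form `τ i = c + i` or `τ i = c - i` such that `dist (P (τ i)) (P (τ j)) = k * dist (W i) (W j)`. -/
def SimilarGon {n : ℕ} (P W : ZMod n → Plane) : Prop :=
  ∃ k : ℝ, 0 < k ∧ ∃ c : ZMod n,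
    ((∀ i j : ZMod n, dist (P (c + i)) (P (c + j)) = k * dist (W i) (W j)) ∨
     (∀ i j : ZMod n, dist (P (c - i)) (P (c - j)) = k * dist (W i) (W j)))

/-- The sequence of iterated pedal polygons of `V` with respect to the points
`X 1, X 2, …` : `pedalSeq V X 0 = V` and `pedalSeq V X k = pedal (pedalSeq V X (k-1)) (X k)`. -/
noncomputable def pedalSeq {n : ℕ} (V : ZMod n → Plane) (X : ℕ → Plane) : ℕ → ZMod n → Plane
  | 0 => V
  | k + 1 => pedal (pedalSeq V X k) (X (k + 1))

/-- `V` and `W` are pedal equivalent (`V ⊥ W`): some iterated pedal polygon of `V`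
(all of whose stages have no three successive vertices collinear) is similar to `W`. -/
def PedalEquiv {n : ℕ} (V W : ZMod n → Plane) : Prop :=
  ∃ m : ℕ, 1 ≤ m ∧ ∃ X : ℕ → Plane,
    (∀ k : ℕ, 1 ≤ k → k ≤ m → NoThreeCollinear (pedalSeq V X k)) ∧
    SimilarGon (pedalSeq V X m) W

/-- A rectangle: a 4-gon with nonzero, pairwise-orthogonal consecutive edge vectors. -/
def IsRectangle (R : ZMod 4 → Plane) : Prop :=
  ∀ i : ZMod 4, R (i + 1) ≠ R i ∧ ⟪R (i + 1) - R i, R (i + 2) - R (i + 1)⟫_ℝ = 0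

/-- A square: a rectangle all of whose sides have the same length. -/
def IsSquareGon (V : ZMod 4 → Plane) : Prop :=
  IsRectangle V ∧ ∀ i j : ZMod 4, dist (V i) (V (i + 1)) = dist (V j) (V (j + 1))

/-- The point with coordinates `(a, b)` in the frame with origin `M` and axes `e`, `f`. -/
def framePoint (M e f : Plane) (a b : ℝ) : Plane := M + a • e + b • f

lemma framePoint_sub_framePoint (M e f : Plane) (a b c d : ℝ) :
    framePoint M e f c d - framePoint M e f a b = (c - a) • e + (d - b) • f := by
  unfold framePoint
  module

lemma inner_smul_add_smul {e f : Plane} {s : ℝ} (hef : ⟪e, f⟫_ℝ = 0) (he : ⟪e, e⟫_ℝ = s)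
    (hf : ⟪f, f⟫_ℝ = s) (a b c d : ℝ) :
    ⟪a • e + b • f, c • e + d • f⟫_ℝ = s * (a * c + b * d) := by
  have hfe : ⟪f, e⟫_ℝ = 0 := by rw [real_inner_comm, hef]
  simp only [inner_add_left, inner_add_right, real_inner_smul_left, real_inner_smul_right,
    hef, hfe, he, hf]
  ring

lemma foot_framePoint {M e f : Plane} {s : ℝ} (hs : s ≠ 0) (hef : ⟪e, f⟫_ℝ = 0)
    (he : ⟪e, e⟫_ℝ = s) (hf : ⟪f, f⟫_ℝ = s) {a b c d x y : ℝ} (t : ℝ)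
    (hne : (c - a) * (c - a) + (d - b) * (d - b) ≠ 0)
    (ht : (x - a) * (c - a) + (y - b) * (d - b) =
      t * ((c - a) * (c - a) + (d - b) * (d - b))) :
    foot (framePoint M e f a b) (framePoint M e f c d) (framePoint M e f x y) =
      framePoint M e f (a + t * (c - a)) (b + t * (d - b)) := by
  have hq : s * ((x - a) * (c - a) + (y - b) * (d - b)) /
      (s * ((c - a) * (c - a) + (d - b) * (d - b))) = t := by
    rw [ht, mul_div_mul_left _ _ hs, mul_div_cancel_right₀ _ hne]
  simp only [foot, framePoint_sub_framePoint, inner_smul_add_smul hef he hf, hq]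
  unfold framePoint
  module

lemma not_collinear_framePoint {M e f : Plane} {s : ℝ} (hs : s ≠ 0) (hef : ⟪e, f⟫_ℝ = 0)
    (he : ⟪e, e⟫_ℝ = s) (hf : ⟪f, f⟫_ℝ = s) {a b c d x y : ℝ}
    (hdet : (c - a) * (y - b) - (x - a) * (d - b) ≠ 0) :
    ¬ Collinear ℝ ({framePoint M e f a b, framePoint M e f c d, framePoint M e f x y} :
      Set Plane) := by
  intro hcol
  obtain ⟨v, hv⟩ := (collinear_iff_of_mem (p₀ := framePoint M e f a b) (by simp)).1 hcol
  obtain ⟨r, hr⟩ := hv (framePoint M e f c d) (by simp)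
  obtain ⟨q, hq⟩ := hv (framePoint M e f x y) (by simp)
  rw [vadd_eq_add, ← sub_eq_iff_eq_add, framePoint_sub_framePoint] at hr hq
  have key (g : Plane) {a b r : ℝ} (h : a • e + b • f = r • v) :
      a * ⟪e, g⟫_ℝ + b * ⟪f, g⟫_ℝ = r * ⟪v, g⟫_ℝ := by
    have := congrArg (fun w => ⟪w, g⟫_ℝ) h
    simpa only [inner_add_left, real_inner_smul_left] using this
  have h1 := key e hr
  have h2 := key f hr
  have h3 := key e hq
  have h4 := key f hq
  have hfe : ⟪f, e⟫_ℝ = 0 := by rw [real_inner_comm, hef]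
  rw [hef, hf] at h2 h4
  rw [hfe, he] at h1 h3
  apply hdet
  have : s * s * ((c - a) * (y - b) - (x - a) * (d - b)) = 0 := by
    linear_combination (s * (y - b)) * h1 + r * ⟪v, e⟫_ℝ * h4 - (s * (d - b)) * h3 -
      q * ⟪v, e⟫_ℝ * h2
  simpa [hs] using this

lemma eq_zero_of_inner_eq_zero {u v m : Plane} (hu : u ≠ 0) (hv : v ≠ 0) (huv : ⟪u, v⟫_ℝ = 0)
    (hmu : ⟪m, u⟫_ℝ = 0) (hmv : ⟪m, v⟫_ℝ = 0) : m = 0 := by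
  have hu' := (inner_self_ne_zero (𝕜 := ℝ)).2 hu
  have hv' := (inner_self_ne_zero (𝕜 := ℝ)).2 hv
  simp only [PiLp.inner_apply, Fin.sum_univ_two, RCLike.inner_apply, conj_trivial] at *
  have hdet : (u 0 * v 1 - u 1 * v 0) ≠ 0 := by
    intro h
    apply mul_ne_zero hu' hv'
    linear_combination (u 0 * v 1 - u 1 * v 0) * h + (v 0 * u 0 + v 1 * u 1) * huv
  ext i
  fin_cases i
  · apply mul_left_cancel₀ hdet
    simp only [Fin.zero_eta, PiLp.zero_apply]
    linear_combination v 1 * hmu - u 1 * hmv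
  · apply mul_left_cancel₀ hdet
    simp only [Fin.mk_one, PiLp.zero_apply]
    linear_combination u 0 * hmv - v 0 * hmu

lemma IsRectangle.exists_frame {R : ZMod 4 → Plane} (hR : IsRectangle R) :
    ∃ M e f : Plane, e ≠ 0 ∧ f ≠ 0 ∧ ⟪e, f⟫_ℝ = 0 ∧ R 0 = framePoint M e f (-1) (-1) ∧
      R 1 = framePoint M e f 1 (-1) ∧ R 2 = framePoint M e f 1 1 ∧
      R 3 = framePoint M e f (-1) 1 := by
  obtain ⟨hu, huv⟩ := hR 0
  obtain ⟨hv, hvw⟩ := hR 1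
  obtain ⟨-, hzu⟩ := hR 3
  rw [show (0 : ZMod 4) + 1 = 1 from rfl] at hu huv
  rw [show (0 : ZMod 4) + 2 = 2 from rfl] at huv
  rw [show (1 : ZMod 4) + 1 = 2 from rfl] at hv hvw
  rw [show (1 : ZMod 4) + 2 = 3 from rfl] at hvw
  rw [show (3 : ZMod 4) + 1 = 0 from rfl, show (3 : ZMod 4) + 2 = 1 from rfl] at hzu
  rw [← sub_ne_zero] at hu hv
  have hm : (R 1 - R 0) + (R 3 - R 2) = 0 := by
    apply eq_zero_of_inner_eq_zero hu hv huv
    · have h : (R 1 - R 0) + (R 3 - R 2) = -(R 0 - R 3) - (R 2 - R 1) := by abel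
      rw [h, inner_sub_left, inner_neg_left, hzu, real_inner_comm, huv]
      simp
    · rw [inner_add_left, huv, real_inner_comm, hvw, add_zero]
  have h3 : R 3 = R 0 + (R 2 - R 1) := by
    rw [← sub_eq_zero, ← hm]
    abel
  refine ⟨(1 / 2 : ℝ) • (R 0 + R 2), (1 / 2 : ℝ) • (R 1 - R 0), (1 / 2 : ℝ) • (R 2 - R 1),
    smul_ne_zero (by norm_num) hu, smul_ne_zero (by norm_num) hv, ?_, ?_, ?_, ?_, ?_⟩
  · rw [real_inner_smul_left, real_inner_smul_right, huv]
    simp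
  · unfold framePoint
    module
  · unfold framePoint
    module
  · unfold framePoint
    module
  · rw [h3]
    unfold framePoint
    module

lemma dist_framePoint {M e f : Plane} (hef : ⟪e, f⟫_ℝ = 0) (a b c d : ℝ) :
    dist (framePoint M e f a b) (framePoint M e f c d) =
      √((a - c) ^ 2 * ‖e‖ ^ 2 + (b - d) ^ 2 * ‖f‖ ^ 2) := by
  have hfe : ⟪f, e⟫_ℝ = 0 := by rw [real_inner_comm, hef]
  rw [dist_eq_norm, framePoint_sub_framePoint, norm_eq_sqrt_real_inner]
  simp only [inner_add_left, inner_add_right, real_inner_smul_left, real_inner_smul_right,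
    hef, hfe]
  rw [real_inner_self_eq_norm_sq, real_inner_self_eq_norm_sq]
  ring_nf

/-- A closed form for the pedal polygon of a square, taken with respect to a point on the
midline parallel to the first side. -/
lemma pedal_of_square {V : ZMod 4 → Plane} {M e f : Plane} {s : ℝ} (hs : s ≠ 0)
    (hef : ⟪e, f⟫_ℝ = 0) (he : ⟪e, e⟫_ℝ = s) (hf : ⟪f, f⟫_ℝ = s)
    (h0 : V 0 = framePoint M e f (-1) (-1)) (h1 : V 1 = framePoint M e f 1 (-1))
    (h2 : V 2 = framePoint M e f 1 1) (h3 : V 3 = framePoint M e f (-1) 1) (x : ℝ) :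
    pedal V (framePoint M e f x 0) 0 = framePoint M e f x (-1) ∧
    pedal V (framePoint M e f x 0) 1 = framePoint M e f 1 0 ∧
    pedal V (framePoint M e f x 0) 2 = framePoint M e f x 1 ∧
    pedal V (framePoint M e f x 0) 3 = framePoint M e f (-1) 0 := by
  refine ⟨?_, ?_, ?_, ?_⟩
  · change foot (V 0) (V 1) _ = _
    rw [h0, h1, foot_framePoint hs hef he hf ((x + 1) / 2) (by norm_num) (by ring)]
    congr 1 <;> ring
  · change foot (V 1) (V 2) _ = _
    rw [h1, h2, foot_framePoint hs hef he hf (1 / 2) (by norm_num) (by ring)]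
    congr 1 <;> ring
  · change foot (V 2) (V 3) _ = _
    rw [h2, h3, foot_framePoint hs hef he hf ((1 - x) / 2) (by norm_num) (by ring)]
    congr 1 <;> ring
  · change foot (V 3) (V 0) _ = _
    rw [h3, h0, foot_framePoint hs hef he hf (1 / 2) (by norm_num) (by ring)]
    congr 1 <;> ring

/-- A kite with perpendicular diagonals of equal length has a rectangle, with sides parallel to
the diagonals, among its pedal polygons. -/
lemma pedal_of_kite {P : ZMod 4 → Plane} {M e f : Plane} {s : ℝ} (hs : s ≠ 0)
    (hef : ⟪e, f⟫_ℝ = 0) (he : ⟪e, e⟫_ℝ = s) (hf : ⟪f, f⟫_ℝ = s) {x : ℝ} (hx : 2 - x ^ 2 ≠ 0)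
    (h0 : P 0 = framePoint M e f x (-1)) (h1 : P 1 = framePoint M e f 1 0)
    (h2 : P 2 = framePoint M e f x 1) (h3 : P 3 = framePoint M e f (-1) 0) :
    let X := framePoint M e f (x - 2 * x / (2 - x ^ 2)) 0
    let m := x + (1 - x) / (2 - x ^ 2)
    let m' := x - (1 + x) / (2 - x ^ 2)
    let y := (1 - x ^ 2) / (2 - x ^ 2)
    pedal P X 0 = framePoint M e f m (-y) ∧ pedal P X 1 = framePoint M e f m y ∧
    pedal P X 2 = framePoint M e f m' y ∧ pedal P X 3 = framePoint M e f m' (-y) := by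
  intro X m m' y
  refine ⟨?_, ?_, ?_, ?_⟩
  · change foot (P 0) (P 1) _ = _
    rw [h0, h1, foot_framePoint hs hef he hf (1 / (2 - x ^ 2)) (by nlinarith [sq_nonneg (1 - x)])
      (by field_simp; ring)]
    congr 1 <;> simp only [m, y] <;> grind
  · change foot (P 1) (P 2) _ = _
    rw [h1, h2, foot_framePoint hs hef he hf y (by nlinarith [sq_nonneg (1 - x)])
      (by simp only [y]; field_simp; ring)]
    congr 1 <;> simp only [m, y] <;> field_simp <;> ring
  · change foot (P 2) (P 3) _ = _
    rw [h2, h3, foot_framePoint hs hef he hf (1 / (2 - x ^ 2)) (by nlinarith [sq_nonneg (1 + x)])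
      (by field_simp; ring)]
    congr 1 <;> simp only [m', y] <;> field_simp <;> ring
  · change foot (P 3) (P 0) _ = _
    rw [h3, h0, foot_framePoint hs hef he hf y (by nlinarith [sq_nonneg (1 + x)])
      (by simp only [y]; field_simp; ring)]
    congr 1 <;> simp only [m', y] <;> field_simp <;> ring

lemma exists_abs_one_sub_sq_eq {q : ℝ} (hq : 0 < q) :
    ∃ x : ℝ, |1 - x ^ 2| = q ∧ 2 - x ^ 2 ≠ 0 := by
  by_cases h : q = 1
  · exact ⟨0, by simp [h]⟩
  · refine ⟨√(1 + q), ?_, ?_⟩ <;> rw [Real.sq_sqrt (by linarith)]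
    · rw [show 1 - (1 + q) = -q by ring, abs_neg, abs_of_pos hq]
    · intro h'
      exact h (by linarith)

lemma noThreeCollinear_of_kite {P : ZMod 4 → Plane} {M e f : Plane} {s : ℝ} (hs : s ≠ 0)
    (hef : ⟪e, f⟫_ℝ = 0) (he : ⟪e, e⟫_ℝ = s) (hf : ⟪f, f⟫_ℝ = s) {x : ℝ} (hx : 1 - x ^ 2 ≠ 0)
    (h0 : P 0 = framePoint M e f x (-1)) (h1 : P 1 = framePoint M e f 1 0)
    (h2 : P 2 = framePoint M e f x 1) (h3 : P 3 = framePoint M e f (-1) 0) :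
    NoThreeCollinear P := by
  intro i
  fin_cases i
  · change ¬ Collinear ℝ {P 0, P 1, P 2}
    rw [h0, h1, h2]
    refine not_collinear_framePoint hs hef he hf fun h => hx ?_
    linear_combination (1 + x) / 2 * h
  · change ¬ Collinear ℝ {P 1, P 2, P 3}
    rw [h1, h2, h3]
    exact not_collinear_framePoint hs hef he hf (by norm_num)
  · change ¬ Collinear ℝ {P 2, P 3, P 0}
    rw [h2, h3, h0]
    refine not_collinear_framePoint hs hef he hf fun h => hx ?_
    linear_combination (1 - x) / 2 * h
  · change ¬ Collinear ℝ {P 3, P 0, P 1}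
    rw [h3, h0, h1]
    exact not_collinear_framePoint hs hef he hf (by norm_num)

lemma noThreeCollinear_of_rectangle {P : ZMod 4 → Plane} {M e f : Plane} {s : ℝ} (hs : s ≠ 0)
    (hef : ⟪e, f⟫_ℝ = 0) (he : ⟪e, e⟫_ℝ = s) (hf : ⟪f, f⟫_ℝ = s) {a b c d : ℝ}
    (hab : a ≠ b) (hcd : c ≠ d)
    (h0 : P 0 = framePoint M e f a c) (h1 : P 1 = framePoint M e f a d)
    (h2 : P 2 = framePoint M e f b d) (h3 : P 3 = framePoint M e f b c) :
    NoThreeCollinear P := by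
  have key : (b - a) * (d - c) ≠ 0 := mul_ne_zero (sub_ne_zero.2 hab.symm) (sub_ne_zero.2 hcd.symm)
  intro i
  fin_cases i
  · change ¬ Collinear ℝ {P 0, P 1, P 2}
    rw [h0, h1, h2]
    exact not_collinear_framePoint hs hef he hf fun h => key (by linear_combination -h)
  · change ¬ Collinear ℝ {P 1, P 2, P 3}
    rw [h1, h2, h3]
    exact not_collinear_framePoint hs hef he hf fun h => key (by linear_combination -h)
  · change ¬ Collinear ℝ {P 2, P 3, P 0}
    rw [h2, h3, h0]
    exact not_collinear_framePoint hs hef he hf fun h => key (by linear_combination -h)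
  · change ¬ Collinear ℝ {P 3, P 0, P 1}
    rw [h3, h0, h1]
    exact not_collinear_framePoint hs hef he hf fun h => key (by linear_combination -h)

/-- Two rectangles, given by coordinates in orthogonal frames, are similar as soon as their
sides are proportional. -/
lemma similarGon_of_framePoint {P W : ZMod 4 → Plane} {M e f N g h : Plane}
    (hef : ⟪e, f⟫_ℝ = 0) (hgh : ⟪g, h⟫_ℝ = 0) {a b c d k : ℝ} (hk : 0 < k)
    (hP0 : P 0 = framePoint M e f a c) (hP1 : P 1 = framePoint M e f a d)
    (hP2 : P 2 = framePoint M e f b d) (hP3 : P 3 = framePoint M e f b c)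
    (hW0 : W 0 = framePoint N g h (-1) (-1)) (hW1 : W 1 = framePoint N g h 1 (-1))
    (hW2 : W 2 = framePoint N g h 1 1) (hW3 : W 3 = framePoint N g h (-1) 1)
    (hfg : (d - c) ^ 2 * ‖f‖ ^ 2 = k ^ 2 * (4 * ‖g‖ ^ 2))
    (heh : (b - a) ^ 2 * ‖e‖ ^ 2 = k ^ 2 * (4 * ‖h‖ ^ 2)) :
    SimilarGon P W := by
  refine ⟨k, hk, 0, Or.inl fun i j => ?_⟩
  have key {a b c d a' b' c' d' : ℝ}
      (H : (a - c) ^ 2 * ‖e‖ ^ 2 + (b - d) ^ 2 * ‖f‖ ^ 2 =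
        k ^ 2 * ((a' - c') ^ 2 * ‖g‖ ^ 2 + (b' - d') ^ 2 * ‖h‖ ^ 2)) :
      dist (framePoint M e f a b) (framePoint M e f c d) =
        k * dist (framePoint N g h a' b') (framePoint N g h c' d') := by
    rw [dist_framePoint hef, dist_framePoint hgh, H, Real.sqrt_mul (sq_nonneg k),
      Real.sqrt_sq hk.le]
  have cases4 (i : ZMod 4) : i = 0 ∨ i = 1 ∨ i = 2 ∨ i = 3 := by
    revert i
    decide
  rw [zero_add, zero_add]
  obtain rfl | rfl | rfl | rfl := cases4 i <;> obtain rfl | rfl | rfl | rfl := cases4 j <;>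
    simp only [hP0, hP1, hP2, hP3, hW0, hW1, hW2, hW3] <;> apply key <;> grind

lemma exists_pedal_pedal_similarGon {V W : ZMod 4 → Plane} (hV : IsSquareGon V)
    (hW : IsRectangle W) :
    ∃ X₁ X₂ : Plane, NoThreeCollinear (pedal V X₁) ∧ NoThreeCollinear (pedal (pedal V X₁) X₂) ∧
      SimilarGon (pedal (pedal V X₁) X₂) W := by
  obtain ⟨hVr, hVs⟩ := hV
  obtain ⟨M, e, f, he0, -, hef, hV0, hV1, hV2, hV3⟩ := hVr.exists_frame
  obtain ⟨N, g, h, hg0, hh0, hgh, hW0, hW1, hW2, hW3⟩ := hW.exists_frame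
  have hdist := hVs 0 1
  rw [show (0 : ZMod 4) + 1 = 1 from rfl, show (1 : ZMod 4) + 1 = 2 from rfl, hV0, hV1, hV2,
    dist_framePoint hef, dist_framePoint hef, Real.sqrt_inj (by positivity) (by positivity)] at hdist
  have hnorm : ‖f‖ ^ 2 = ‖e‖ ^ 2 := by linarith
  have hs : ‖e‖ ^ 2 ≠ 0 := by simpa using he0
  have he := real_inner_self_eq_norm_sq e
  have hf : ⟪f, f⟫_ℝ = ‖e‖ ^ 2 := by rw [real_inner_self_eq_norm_sq, hnorm]
  have hg : 0 < ‖g‖ := norm_pos_iff.2 hg0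
  have hh : 0 < ‖h‖ := norm_pos_iff.2 hh0
  obtain ⟨x, hx, hd⟩ := exists_abs_one_sub_sq_eq (div_pos hg hh)
  have hx0 : 1 - x ^ 2 ≠ 0 := by
    rw [← abs_pos, hx]
    positivity
  have hx2 : (1 - x ^ 2) ^ 2 * ‖h‖ ^ 2 = ‖g‖ ^ 2 := by
    rw [← sq_abs, hx]
    field_simp
  obtain ⟨hP0, hP1, hP2, hP3⟩ := pedal_of_square hs hef he hf hV0 hV1 hV2 hV3 x
  obtain ⟨hQ0, hQ1, hQ2, hQ3⟩ := pedal_of_kite hs hef he hf hd hP0 hP1 hP2 hP3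
  have hk : (‖e‖ / (|2 - x ^ 2| * ‖h‖)) ^ 2 = ‖e‖ ^ 2 / ((2 - x ^ 2) ^ 2 * ‖h‖ ^ 2) := by
    rw [div_pow, mul_pow, sq_abs]
  refine ⟨_, _, noThreeCollinear_of_kite hs hef he hf hx0 hP0 hP1 hP2 hP3,
    noThreeCollinear_of_rectangle hs hef he hf ?_ ?_ hQ0 hQ1 hQ2 hQ3,
    similarGon_of_framePoint hef hgh (k := ‖e‖ / (|2 - x ^ 2| * ‖h‖)) ?_
      hQ0 hQ1 hQ2 hQ3 hW0 hW1 hW2 hW3 ?_ ?_⟩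
  · rw [← sub_ne_zero, show x + (1 - x) / (2 - x ^ 2) - (x - (1 + x) / (2 - x ^ 2)) =
      2 / (2 - x ^ 2) by ring]
    exact div_ne_zero two_ne_zero hd
  · exact neg_ne_self.2 (div_ne_zero hx0 hd)
  · have := norm_pos_iff.2 he0
    have := abs_pos.2 hd
    positivity
  · rw [hk, hnorm, ← hx2]
    field_simp
    ring
  · rw [hk]
    field_simp
    ring

/-- **Squares are pedal equivalent to all rectangles.** For any square `V` and any
rectangle `W` there are points `X₁, X₂` such that the twice-iterated pedal polygon
`𝒫(𝒫(V,X₁),X₂)` is well defined (the intermediate polygon has no three successive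
vertices collinear) and is similar to `W`; in particular `V ⊥ W`. -/
theorem square_pedalEquiv_rectangle
    (V W : ZMod 4 → Plane)
    (hV : IsSquareGon V) (hW : IsRectangle W) :
    (∃ X₁ X₂ : Plane,
      NoThreeCollinear (pedal V X₁) ∧ SimilarGon (pedal (pedal V X₁) X₂) W) ∧
    PedalEquiv V W := by
  obtain ⟨X₁, X₂, h₁, h₂, h⟩ := exists_pedal_pedal_similarGon hV hW
  refine ⟨⟨X₁, X₂, h₁, h⟩, 2, by norm_num, fun k => if k = 1 then X₁ else X₂, ?_, ?_⟩
  · intro k hk hk2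
    interval_cases k
    · simpa [pedalSeq] using h₁
    · simpa [pedalSeq] using h₂
  · simpa [pedalSeq] using h
end
end

section
/- Every kite is a pedal polygon of a rectangle: for every kite K = (K_1,K_2,K_3,K_4) in ℝ² there exist a rectangle R = (R_1,R_2,R_3,R_4) and a point X ∈ ℝ² such that 𝒫(R,X) = K (equality of 4-gons, with matching labels). -/
open scoped InnerProductSpace

noncomputable section

/-- A kite: a 4-gon `(K₁,K₂,K₃,K₄)` (here indexed `0,1,2,3`) with no three successive
vertices collinear such that `dist K₁ K₂ = dist K₁ K₄` and `dist K₃ K₂ = dist K₃ K₄`. -/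
def IsKite (K : ZMod 4 → Plane) : Prop :=
  NoThreeCollinear K ∧ dist (K 0) (K 1) = dist (K 0) (K 3) ∧
    dist (K 2) (K 1) = dist (K 2) (K 3)

/-- A point `P` of the line `AB` such that `X - P` is orthogonal to the line is the foot
of the perpendicular from `X`. -/
theorem foot_eq_of_inner_eq_zero {A B X P : Plane} (hAB : B ≠ A) (c : ℝ)
    (hP : P - A = c • (B - A)) (hX : ⟪X - P, B - A⟫_ℝ = 0) : foot A B X = P := by
  have h0 : ⟪B - A, B - A⟫_ℝ ≠ 0 := inner_self_ne_zero.2 (sub_ne_zero.2 hAB)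
  have h1 : ⟪X - A, B - A⟫_ℝ = c * ⟪B - A, B - A⟫_ℝ := by
    rw [← sub_add_sub_cancel X P A, inner_add_left, hX, hP, real_inner_smul_left, zero_add]
  rw [foot, h1, mul_div_cancel_right₀ _ h0, ← hP, add_sub_cancel]

/-- In the plane, the vectors orthogonal to a nonzero vector `w` are the multiples of a
single vector. -/
theorem exists_forall_orthogonal_eq_smul {w : Plane} (hw : w ≠ 0) :
    ∃ e : Plane, ⟪e, w⟫_ℝ = 0 ∧ ∀ u : Plane, ⟪u, w⟫_ℝ = 0 → ∃ s : ℝ, u = s • e := by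
  have hn : w 0 ^ 2 + w 1 ^ 2 ≠ 0 := by
    intro h
    apply hw
    ext i
    fin_cases i
    · simp; nlinarith [sq_nonneg (w 0), sq_nonneg (w 1)]
    · simp; nlinarith [sq_nonneg (w 0), sq_nonneg (w 1)]
  refine ⟨!₂[-w 1, w 0], by simp [PiLp.inner_apply, Fin.sum_univ_two]; ring, fun u hu => ?_⟩
  have hu' : u 0 * w 0 + u 1 * w 1 = 0 := by
    simp [PiLp.inner_apply, Fin.sum_univ_two] at hu
    linarith
  refine ⟨(u 1 * w 0 - u 0 * w 1) / (w 0 ^ 2 + w 1 ^ 2), ?_⟩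
  ext i
  fin_cases i
  · simp
    field_simp
    linear_combination w 0 * hu'
  · simp
    field_simp
    linear_combination w 1 * hu'

/-- A point equidistant from `A` and `B` lies on the perpendicular bisector of `AB`. -/
theorem inner_sub_midpoint_eq_zero {P A B : Plane} (h : dist P A = dist P B) :
    ⟪P - midpoint ℝ A B, A - midpoint ℝ A B⟫_ℝ = 0 := by
  have h1 := AffineSubspace.mem_perpBisector_iff_inner_eq_zero.1
    (AffineSubspace.mem_perpBisector_iff_dist_eq.2 h)
  rw [vsub_eq_sub, vsub_eq_sub] at h1
  rw [left_sub_midpoint, real_inner_smul_right, ← neg_sub B A, inner_neg_right, h1]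
  simp

/-- **Every kite is a pedal polygon of a rectangle**: for every kite `K` there are a
rectangle `R` and a point `X` with `𝒫(R,X) = K` (with matching labels). -/
theorem kite_eq_pedal_of_rectangle
    (K : ZMod 4 → Plane) (hK : IsKite K) :
    ∃ (R : ZMod 4 → Plane) (X : Plane), IsRectangle R ∧ pedal R X = K := by
  obtain ⟨hN, h0, h2⟩ := hK
  have h13 : K 1 ≠ K 3 := by
    intro h
    apply hN 1
    rw [show (1 + 1 : ZMod 4) = 2 from rfl, show (1 + 2 : ZMod 4) = 3 from rfl, ← h]
    simpa [Set.pair_comm] using collinear_pair ℝ (K 1) (K 2)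
  have h02 : K 0 ≠ K 2 := by
    intro h
    apply hN 0
    rw [zero_add, zero_add, ← h]
    simpa [Set.pair_comm] using collinear_pair ℝ (K 0) (K 1)
  obtain ⟨X, hX⟩ : ∃ X, X = midpoint ℝ (K 1) (K 3) := ⟨_, rfl⟩
  obtain ⟨w, hw⟩ : ∃ w, w = K 1 - X := ⟨_, rfl⟩
  have hK1 : K 1 = X + w := by rw [hw]; abel
  have hK3 : K 3 = X - w := by
    have : K 1 - X = X - K 3 := by rw [hX, left_sub_midpoint, midpoint_sub_right]
    rw [hw, this]; abel
  have hw0 : w ≠ 0 := by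
    rintro rfl
    exact h13 (by rw [hK1, hK3, add_zero, sub_zero])
  obtain ⟨e, hew, he⟩ := exists_forall_orthogonal_eq_smul hw0
  obtain ⟨s, hs⟩ := he (K 0 - X) (by rw [hw, hX]; exact inner_sub_midpoint_eq_zero h0)
  obtain ⟨t, ht⟩ := he (K 2 - X) (by rw [hw, hX]; exact inner_sub_midpoint_eq_zero h2)
  have hK0 : K 0 = X + s • e := by rw [← hs]; abel
  have hK2 : K 2 = X + t • e := by rw [← ht]; abel
  have hst : s ≠ t := by
    rintro rfl
    exact h02 (hK0.trans hK2.symm)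
  have he0 : e ≠ 0 := by
    rintro rfl
    exact h02 (by rw [hK0, hK2, smul_zero, smul_zero])
  have hwe : ⟪w, e⟫_ℝ = 0 := by rw [real_inner_comm, hew]
  have hst' : s - t ≠ 0 := sub_ne_zero.2 hst
  have hts' : t - s ≠ 0 := sub_ne_zero.2 hst.symm
  let R : ZMod 4 → Plane :=
    (![X + s • e - w, X + s • e + w, X + t • e + w, X + t • e - w] : Fin 4 → Plane)
  have d0 : R 1 - R 0 = (2 : ℝ) • w := by
    change (X + s • e + w) - (X + s • e - w) = _
    module
  have d1 : R 2 - R 1 = (t - s) • e := by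
    change (X + t • e + w) - (X + s • e + w) = _
    module
  have d2 : R 3 - R 2 = (-2 : ℝ) • w := by
    change (X + t • e - w) - (X + t • e + w) = _
    module
  have d3 : R 0 - R 3 = (s - t) • e := by
    change (X + s • e - w) - (X + t • e - w) = _
    module
  have hR : IsRectangle R := by
    intro i
    rw [← sub_ne_zero]
    fin_cases i
    · change R 1 - R 0 ≠ 0 ∧ ⟪R 1 - R 0, R 2 - R 1⟫_ℝ = 0
      simp [d0, d1, real_inner_smul_left, real_inner_smul_right, hwe, hw0]
    · change R 2 - R 1 ≠ 0 ∧ ⟪R 2 - R 1, R 3 - R 2⟫_ℝ = 0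
      simp [d1, d2, real_inner_smul_left, real_inner_smul_right, hew, he0, hts']
    · change R 3 - R 2 ≠ 0 ∧ ⟪R 3 - R 2, R 0 - R 3⟫_ℝ = 0
      simp [d2, d3, real_inner_smul_left, real_inner_smul_right, hwe, hw0]
    · change R 0 - R 3 ≠ 0 ∧ ⟪R 0 - R 3, R 1 - R 0⟫_ℝ = 0
      simp [d3, d0, real_inner_smul_left, real_inner_smul_right, hew, he0, hst']
  refine ⟨R, X, hR, ?_⟩
  funext i
  have hne := (hR i).1
  fin_cases i
  · change foot (R 0) (R 1) X = K 0
    refine foot_eq_of_inner_eq_zero hne (1 / 2) ?_ ?_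
    · rw [d0, hK0]
      change X + s • e - (X + s • e - w) = _
      module
    · rw [d0, hK0]
      simp [real_inner_smul_left, real_inner_smul_right, hew]
  · change foot (R 1) (R 2) X = K 1
    refine foot_eq_of_inner_eq_zero hne (-s / (t - s)) ?_ ?_
    · rw [d1, hK1, smul_smul, div_mul_cancel₀ _ hts']
      change X + w - (X + s • e + w) = _
      module
    · rw [d1, hK1]
      simp [real_inner_smul_right, hwe]
  · change foot (R 2) (R 3) X = K 2
    refine foot_eq_of_inner_eq_zero hne (1 / 2) ?_ ?_
    · rw [d2, hK2]
      change X + t • e - (X + t • e + w) = _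
      module
    · rw [d2, hK2]
      simp [real_inner_smul_left, real_inner_smul_right, hew]
  · change foot (R 3) (R 0) X = K 3
    refine foot_eq_of_inner_eq_zero hne (-t / (s - t)) ?_ ?_
    · rw [d3, hK3, smul_smul, div_mul_cancel₀ _ hst']
      change X - w - (X + t • e - w) = _
      module
    · rw [d3, hK3]
      simp [real_inner_smul_right, hwe]
end
end
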